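/- arXiv:2604.04757 — 8 statements merged into one kernel-verified Lean document; each statement's English description precedes it below -/
import Mathlib

section
/- (Exact error probability of the bundle sampler) Let L ≥ 1, let x_1, …, x_L ∈ 𝒳 be a fixed bundle, let lab : 𝒳 → {0,1} be a labeling function, and let (I'_0, I'_1, I_⋆) be a partition of {1,…,L} with |I'_0| = |I'_1| = m and with I'_c ⊆ {i : lab(x_i) = c} for c ∈ {0,1}. Fix an input bit b ∈ {0,1}, let r be uniform on {0,1}, set β := b ⊕ r, and choose J as follows: with probability |I_⋆|/L sample J uniformly from I_⋆ (independently of β), and otherwise sample J uniformly from I'_β. Define the decoded bit Decode := lab(x_J) ⊕ r. Then for each fixed b, Pr[Decode ≠ b] = |I_⋆|/(2L), where the probability is over r, the branch choice, and J. -/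
/-- **Exact error probability of the bundle sampler.**
A fixed bundle `x₁, …, x_L ∈ 𝒳`, a labeling `lab : 𝒳 → {0,1}`, and a partition
`(I'₀, I'₁, I⋆)` of `{1, …, L}` with `|I'₀| = |I'₁| = m` and `I'_c` contained
in the indices labeled `c`.  For a fixed input bit `b`, with `r` a uniform mask
bit and `β = b ⊕ r`, the index `J` is drawn from `I⋆` (uniformly) with
probability `|I⋆|/L` and otherwise uniformly from `I'_β`; the decoded bit is
`lab(x_J) ⊕ r`.  The probability of decoding error (written explicitly as the
average over `r` of the two-branch mixture) equals exactly `|I⋆|/(2L)`. -/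
theorem stmt4 {𝒳 : Type*} (L m : ℕ) (hL : 1 ≤ L) (x : Fin L → 𝒳)
    (lab : 𝒳 → Bool) (I0 I1 Istar : Finset (Fin L))
    (hdisj01 : Disjoint I0 I1) (hdisj0s : Disjoint I0 Istar)
    (hdisj1s : Disjoint I1 Istar)
    (hcover : I0 ∪ I1 ∪ Istar = Finset.univ)
    (hc0 : I0.card = m) (hc1 : I1.card = m)
    (hsub0 : ∀ j ∈ I0, lab (x j) = false)
    (hsub1 : ∀ j ∈ I1, lab (x j) = true)
    (b : Bool) :
    (1 / 2 : ℝ) * ∑ r : Bool,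
      ((Istar.card : ℝ) / L *
          ∑ j ∈ Istar, (1 / (Istar.card : ℝ)) *
            (if xor (lab (x j)) r = b then 0 else 1)
        + (1 - (Istar.card : ℝ) / L) *
          ∑ j ∈ (if xor b r then I1 else I0), (1 / (m : ℝ)) *
            (if xor (lab (x j)) r = b then 0 else 1))
      = (Istar.card : ℝ) / (2 * L) := by
  have h2 : ∀ r : Bool, ∑ j ∈ (if xor b r then I1 else I0), (1 / (m : ℝ)) *
      (if xor (lab (x j)) r = b then (0 : ℝ) else 1) = 0 := by
    intro r
    apply Finset.sum_eq_zero
    intro j hj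
    cases b <;> cases r <;> simp at hj <;> simp [hsub0, hsub1, hj]
  have h1 : ∑ r : Bool, ∑ j ∈ Istar, (1 / (Istar.card : ℝ)) *
      (if xor (lab (x j)) r = b then (0 : ℝ) else 1)
      = Istar.card * (1 / (Istar.card : ℝ)) := by
    rw [Finset.sum_comm, ← nsmul_eq_mul, ← Finset.sum_const]
    apply Finset.sum_congr rfl
    intro j _
    rw [Fintype.sum_bool]
    cases b <;> cases lab (x j) <;> simp
  simp only [h2, mul_zero, add_zero]
  rw [← Finset.mul_sum, h1]
  have hL' : (L : ℝ) ≠ 0 := by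
    have : L ≠ 0 := by omega
    exact_mod_cast this
  by_cases hs : (Istar.card : ℝ) = 0
  · simp [hs]
  · field_simp
end

section
/- (Statistical core of the impossibility of public pseudorandom codes) Fix p ∈ (0,1/2) and n ≥ 1. Let D_0, D_1 be probability distributions on {0,1}^n such that the mixture (1/2)·D_0 + (1/2)·D_1 is exactly the uniform distribution on {0,1}^n. Let f : {0,1}^n → {0,1} be any function and let ε ≤ 1/2 satisfy, for each i ∈ {0,1}, Pr_{x∼D_i, e∼Ber(p)^n}[ f(x ⊕ e) = i ] ≥ 1 − ε. Then ε ≥ (3/4)·p·(1−p). -/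
/-- Noise correlation form. -/
noncomputable def noiseS (p : ℝ) (n : ℕ) (d F : (Fin n → Bool) → ℝ) : ℝ :=
  ∑ x : Fin n → Bool, ∑ e : Fin n → Bool,
    d x * (∏ j, if e j then p else 1 - p) * F (fun j => xor (x j) (e j))

theorem sum_cons_bool (n : ℕ) (g : (Fin (n + 1) → Bool) → ℝ) :
    ∑ x, g x = ∑ x : Fin n → Bool, (g (Fin.cons false x) + g (Fin.cons true x)) := by
  rw [← (Fin.consEquiv (fun _ : Fin (n + 1) => Bool)).sum_comp g, Fintype.sum_prod_type,
    Finset.sum_add_distrib]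
  simp [Fin.consEquiv, add_comm]

theorem xor_cons (n : ℕ) (a b : Bool) (x e : Fin n → Bool) :
    (fun j => xor ((Fin.cons a x : Fin (n + 1) → Bool) j) ((Fin.cons b e : Fin (n + 1) → Bool) j))
      = (Fin.cons (xor a b) (fun j => xor (x j) (e j)) : Fin (n + 1) → Bool) := by
  funext j
  refine Fin.cases ?_ (fun i => ?_) j <;> simp

theorem sum_weight (p : ℝ) (n : ℕ) :
    ∑ e : Fin n → Bool, (∏ j, if e j then p else 1 - p) = 1 := by
  induction n with
  | zero => simp
  | succ n ih =>
    rw [sum_cons_bool]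
    refine Eq.trans (Finset.sum_congr rfl fun e _ => ?_) ih
    simp only [Fin.prod_univ_succ, Fin.cons_zero, Fin.cons_succ]
    simp
    ring

theorem noiseS_succ (p : ℝ) (n : ℕ) (d F : (Fin (n + 1) → Bool) → ℝ) :
    noiseS p (n + 1) d F =
      2 * noiseS p n (fun x => (d (Fin.cons false x) + d (Fin.cons true x)) / 2)
          (fun x => (F (Fin.cons false x) + F (Fin.cons true x)) / 2)
      + 2 * (1 - 2 * p) * noiseS p n (fun x => (d (Fin.cons false x) - d (Fin.cons true x)) / 2)
          (fun x => (F (Fin.cons false x) - F (Fin.cons true x)) / 2) := by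
  unfold noiseS
  rw [sum_cons_bool, Finset.mul_sum, Finset.mul_sum, ← Finset.sum_add_distrib]
  refine Finset.sum_congr rfl fun x _ => ?_
  rw [sum_cons_bool, sum_cons_bool, Finset.mul_sum, Finset.mul_sum, ← Finset.sum_add_distrib,
    ← Finset.sum_add_distrib]
  refine Finset.sum_congr rfl fun e _ => ?_
  simp only [xor_cons, Fin.prod_univ_succ, Fin.cons_zero, Fin.cons_succ]
  simp
  ring

theorem sq_succ (n : ℕ) (d : (Fin (n + 1) → Bool) → ℝ) :
    ∑ x, d x ^ 2 = 2 * ∑ x : Fin n → Bool, ((d (Fin.cons false x) + d (Fin.cons true x)) / 2) ^ 2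
      + 2 * ∑ x : Fin n → Bool, ((d (Fin.cons false x) - d (Fin.cons true x)) / 2) ^ 2 := by
  rw [sum_cons_bool, Finset.mul_sum, Finset.mul_sum, ← Finset.sum_add_distrib]
  exact Finset.sum_congr rfl fun x _ => by ring

theorem lin_succ (n : ℕ) (d : (Fin (n + 1) → Bool) → ℝ) :
    ∑ x, d x = 2 * ∑ x : Fin n → Bool, ((d (Fin.cons false x) + d (Fin.cons true x)) / 2) := by
  rw [sum_cons_bool, Finset.mul_sum]
  exact Finset.sum_congr rfl fun x _ => by ring

theorem claim1 (p : ℝ) (hp0 : 0 < p) (hp1 : p < 1 / 2) (n : ℕ) :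
    ∀ d F : (Fin n → Bool) → ℝ, 2 * noiseS p n d F ≤ ∑ x, d x ^ 2 + ∑ x, F x ^ 2 := by
  induction n with
  | zero =>
    intro d F
    obtain ⟨c, rfl⟩ : ∃ c, F = fun _ => c :=
      ⟨F default, funext fun x => congrArg F (Subsingleton.elim _ _)⟩
    simp only [noiseS, Fintype.sum_unique, Finset.univ_eq_empty, Finset.prod_empty]
    generalize d _ = t
    nlinarith [sq_nonneg (t - c)]
  | succ n ih =>
    intro d F
    rw [noiseS_succ, sq_succ n d, sq_succ n F]
    have h1 := ih (fun x => (d (Fin.cons false x) + d (Fin.cons true x)) / 2)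
          (fun x => (F (Fin.cons false x) + F (Fin.cons true x)) / 2)
    have h2 := ih (fun x => (d (Fin.cons false x) - d (Fin.cons true x)) / 2)
          (fun x => (F (Fin.cons false x) - F (Fin.cons true x)) / 2)
    have h3 : 0 ≤ ∑ x : Fin n → Bool, ((d (Fin.cons false x) - d (Fin.cons true x)) / 2) ^ 2 :=
      Finset.sum_nonneg fun _ _ => sq_nonneg _
    have h4 : 0 ≤ ∑ x : Fin n → Bool, ((F (Fin.cons false x) - F (Fin.cons true x)) / 2) ^ 2 :=
      Finset.sum_nonneg fun _ _ => sq_nonneg _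
    have h5 := mul_le_mul_of_nonneg_left h2 (by linarith : (0 : ℝ) ≤ 1 - 2 * p)
    have h6 := mul_nonneg hp0.le (add_nonneg h3 h4)
    linarith

theorem claim2 (p : ℝ) (hp0 : 0 < p) (hp1 : p < 1 / 2) (n : ℕ) :
    ∀ d F : (Fin n → Bool) → ℝ, 2 * (2 ^ n * noiseS p n d F - (∑ x, d x) * ∑ x, F x) ≤
      (1 - 2 * p) * (2 ^ n * ∑ x, d x ^ 2 - (∑ x, d x) ^ 2
        + 2 ^ n * ∑ x, F x ^ 2 - (∑ x, F x) ^ 2) := by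
  induction n with
  | zero =>
    intro d F
    obtain ⟨c, rfl⟩ : ∃ c, F = fun _ => c :=
      ⟨F default, funext fun x => congrArg F (Subsingleton.elim _ _)⟩
    simp only [noiseS, Fintype.sum_unique, Finset.univ_eq_empty, Finset.prod_empty]
    apply le_of_eq
    ring
  | succ n ih =>
    intro d F
    rw [noiseS_succ, sq_succ n d, sq_succ n F, lin_succ n d, lin_succ n F]
    have h1 := ih (fun x => (d (Fin.cons false x) + d (Fin.cons true x)) / 2)
          (fun x => (F (Fin.cons false x) + F (Fin.cons true x)) / 2)
    have h2 := claim1 p hp0 hp1 n (fun x => (d (Fin.cons false x) - d (Fin.cons true x)) / 2)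
          (fun x => (F (Fin.cons false x) - F (Fin.cons true x)) / 2)
    have h5 := mul_le_mul_of_nonneg_left h2
      (mul_nonneg (by positivity : (0 : ℝ) ≤ 2 ^ n) (by linarith : (0 : ℝ) ≤ 1 - 2 * p))
    rw [pow_succ]
    linarith

/-- **Statistical core of the impossibility of public pseudorandom codes.**
Fix `p ∈ (0, 1/2)` and `n ≥ 1`.  `D false` and `D true` are distributions on
`{0,1}^n` whose mixture `(1/2)·D₀ + (1/2)·D₁` is exactly uniform.  If a decoder
`f : {0,1}^n → {0,1}` satisfies, for each `i ∈ {0,1}`,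
`Pr_{x ∼ D_i, e ∼ Ber(p)^n}[f(x ⊕ e) = i] ≥ 1 − ε` with `ε ≤ 1/2`,
then `ε ≥ (3/4)·p·(1 − p)`. -/
theorem stmt5 (p : ℝ) (hp0 : 0 < p) (hp1 : p < 1 / 2) (n : ℕ) (hn : 1 ≤ n)
    (D : Bool → (Fin n → Bool) → ℝ)
    (hD0 : ∀ i x, 0 ≤ D i x) (hD1 : ∀ i, ∑ x : Fin n → Bool, D i x = 1)
    (hmix : ∀ x, (1 / 2 : ℝ) * (D false x + D true x) = 1 / 2 ^ n)
    (f : (Fin n → Bool) → Bool) (ε : ℝ) (hε : ε ≤ 1 / 2)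
    (hdec : ∀ i : Bool,
      1 - ε ≤ ∑ x : Fin n → Bool, ∑ e : Fin n → Bool,
        D i x * (∏ j, if e j then p else 1 - p) *
          (if f (fun j => xor (x j) (e j)) = i then 1 else 0)) :
    (3 / 4) * p * (1 - p) ≤ ε := by
  have hN : (0 : ℝ) < 2 ^ n := by positivity
  set F : (Fin n → Bool) → ℝ := fun y => if f y = false then 1 else -1 with hF
  set d : (Fin n → Bool) → ℝ := fun x => 2 ^ n / 2 * (D false x - D true x) with hd
  have hmix' : ∀ x, 2 ^ n / 2 * (D false x + D true x) = 1 := fun x => by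
    have h := hmix x
    field_simp at h ⊢
    linarith
  have hdsum : ∑ x, d x = 0 := by
    simp only [hd]
    rw [← Finset.mul_sum, Finset.sum_sub_distrib, hD1, hD1]
    ring
  have hcard : ∑ x : Fin n → Bool, (1 : ℝ) = 2 ^ n := by simp
  have hdsq : ∑ x, d x ^ 2 ≤ 2 ^ n := by
    rw [← hcard]
    refine Finset.sum_le_sum fun x _ => ?_
    have h := hmix' x
    have h0 := mul_nonneg (by positivity : (0 : ℝ) ≤ 2 ^ n / 2) (hD0 false x)
    have h1 := mul_nonneg (by positivity : (0 : ℝ) ≤ 2 ^ n / 2) (hD0 true x)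
    rw [sq_le_one_iff_abs_le_one, abs_le]
    simp only [hd]
    constructor <;> linarith
  have hFsq : ∑ x, F x ^ 2 = 2 ^ n := by
    rw [← hcard]
    refine Finset.sum_congr rfl fun x _ => ?_
    simp only [hF]
    split_ifs <;> norm_num
  have hc := claim2 p hp0 hp1 n d F
  rw [hdsum, hFsq] at hc
  have hS : noiseS p n d F ≤ (1 - 2 * p) * 2 ^ n := by
    have hr : (0 : ℝ) ≤ 1 - 2 * p := by linarith
    have h1 := mul_le_mul_of_nonneg_left hdsq (mul_nonneg hr hN.le)
    have h2 := mul_nonneg hr (sq_nonneg (∑ x, F x))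
    refine le_of_mul_le_mul_left ?_ hN
    linarith
  have key : 2 ^ n * ((∑ x : Fin n → Bool, ∑ e : Fin n → Bool,
        D false x * (∏ j, if e j then p else 1 - p) *
          (if f (fun j => xor (x j) (e j)) = false then 1 else 0))
      + ∑ x : Fin n → Bool, ∑ e : Fin n → Bool,
        D true x * (∏ j, if e j then p else 1 - p) *
          (if f (fun j => xor (x j) (e j)) = true then 1 else 0)) =
      2 ^ n + noiseS p n d F := by
    have e1 : (2 : ℝ) ^ n = ∑ x : Fin n → Bool, ∑ e : Fin n → Bool,
        (∏ j, if e j then p else 1 - p) := by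
      rw [sum_weight, hcard]
    conv_rhs => rw [e1]
    unfold noiseS
    rw [← Finset.sum_add_distrib, ← Finset.sum_add_distrib, Finset.mul_sum]
    refine Finset.sum_congr rfl fun x _ => ?_
    rw [← Finset.sum_add_distrib, ← Finset.sum_add_distrib, Finset.mul_sum]
    refine Finset.sum_congr rfl fun e _ => ?_
    have h := hmix' x
    generalize (∏ j, if e j then p else 1 - p) = w
    simp only [hF, hd]
    cases f (fun j => xor (x j) (e j))
    · simp
      linear_combination w * h
    · simp
      linear_combination w * h
  have h0 := hdec false
  have h1 := hdec true
  have h2 := mul_le_mul_of_nonneg_left (add_le_add h0 h1) hN.le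
  rw [key] at h2
  have h3 : (1 - ε + (1 - ε)) ≤ 1 + (1 - 2 * p) := by
    refine le_of_mul_le_mul_left ?_ hN
    linarith
  nlinarith
end

section
/- (Correlation forces weighted Fourier mass) Let m_1, m_2 ≥ 1, let p ∈ (0,1/2) and set ρ := 1−2p. Let F_0, G_0 : {0,1}^{m_1} × {0,1}^{m_2} → [−1,1], and define F(x,y) := E_{Z∼Ber(p)^{m_2}}[F_0(x, y ⊕ Z)] and G(x,y) := E_{Z∼Ber(p)^{m_1}}[G_0(x ⊕ Z, y)]. If E_{(X,Y) uniform}[F(X,Y)·G(X,Y)] ≥ δ for some δ > 0, then ∑_{S⊆[m_1], T⊆[m_2]} ρ^{|S|} · F̂(S,T)² ≥ δ². -/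
open Finset

/-- The Walsh character `χ_S(x) = (−1)^{∑_{i ∈ S} x_i}`. -/
noncomputable def chi {m : ℕ} (S : Finset (Fin m)) (x : Fin m → Bool) : ℝ :=
  ∏ i ∈ S, (if x i then (-1 : ℝ) else 1)

/-- The Bernoulli(p) product weight of a noise vector `z ∈ {0,1}^m`. -/
noncomputable def bern {m : ℕ} (p : ℝ) (z : Fin m → Bool) : ℝ :=
  ∏ j, (if z j then p else 1 - p)

/-- The Walsh–Fourier coefficient `ĥ(S,T)` of
`h : {0,1}^{m₁} × {0,1}^{m₂} → ℝ`. -/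
noncomputable def fcoef {m₁ m₂ : ℕ} (h : (Fin m₁ → Bool) → (Fin m₂ → Bool) → ℝ)
    (S : Finset (Fin m₁)) (T : Finset (Fin m₂)) : ℝ :=
  (1 / 2 ^ (m₁ + m₂) : ℝ) *
    ∑ x : Fin m₁ → Bool, ∑ y : Fin m₂ → Bool, h x y * chi S x * chi T y

/-- `F(x,y) := E_{Z ∼ Ber(p)^{m₂}}[F₀(x, y ⊕ Z)]`: noise applied to the
second coordinate. -/
noncomputable def noisyY {m₁ m₂ : ℕ} (p : ℝ)
    (h : (Fin m₁ → Bool) → (Fin m₂ → Bool) → ℝ) :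
    (Fin m₁ → Bool) → (Fin m₂ → Bool) → ℝ :=
  fun x y => ∑ z : Fin m₂ → Bool, bern p z * h x (fun j => xor (y j) (z j))

/-- `G(x,y) := E_{Z ∼ Ber(p)^{m₁}}[G₀(x ⊕ Z, y)]`: noise applied to the
first coordinate. -/
noncomputable def noisyX {m₁ m₂ : ℕ} (p : ℝ)
    (h : (Fin m₁ → Bool) → (Fin m₂ → Bool) → ℝ) :
    (Fin m₁ → Bool) → (Fin m₂ → Bool) → ℝ :=
  fun x y => ∑ z : Fin m₁ → Bool, bern p z * h (fun i => xor (x i) (z i)) y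

/-- Summation is invariant under translation by `z`. -/
lemma sum_xor_shift {m : ℕ} (z : Fin m → Bool) (f : (Fin m → Bool) → ℝ) :
    ∑ x : Fin m → Bool, f (fun i => xor (x i) (z i)) = ∑ x, f x := by
  have hinv : Function.Involutive (fun (x : Fin m → Bool) => fun i => xor (x i) (z i)) := by
    intro x
    funext i
    simp
  exact Equiv.sum_comp hinv.toPerm f

lemma chi_xor {m : ℕ} (S : Finset (Fin m)) (x z : Fin m → Bool) :
    chi S (fun i => xor (x i) (z i)) = chi S x * chi S z := by
  unfold chi
  rw [← Finset.prod_mul_distrib]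
  refine Finset.prod_congr rfl fun i _ => ?_
  rcases hx : x i with _ | _ <;> rcases hz : z i with _ | _ <;> simp [hx, hz]

lemma sum_bern_chi {m : ℕ} (p : ℝ) (S : Finset (Fin m)) :
    ∑ z, bern p z * chi S z = (1 - 2 * p) ^ S.card := by
  have h1 : ∀ z : Fin m → Bool, bern p z * chi S z =
      ∏ i, ((if z i then p else 1 - p) * (if i ∈ S then (if z i then (-1 : ℝ) else 1) else 1)) := by
    intro z
    unfold bern chi
    rw [Finset.prod_mul_distrib]
    congr 1
    rw [Finset.prod_ite_mem, Finset.univ_inter]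
  simp_rw [h1]
  have h2 := (Fintype.prod_sum (fun (i : Fin m) (b : Bool) =>
    ((if b then p else 1 - p) * (if i ∈ S then (if b then (-1 : ℝ) else 1) else 1))))
  rw [← h2]
  have h3 : ∀ i : Fin m, (∑ b : Bool,
      ((if b then p else 1 - p) * (if i ∈ S then (if b then (-1 : ℝ) else 1) else 1)))
      = if i ∈ S then 1 - 2 * p else 1 := by
    intro i
    by_cases h : i ∈ S
    · simp [h]; ring
    · simp [h]
  simp_rw [h3]
  rw [Finset.prod_ite_mem, Finset.univ_inter, Finset.prod_const]

lemma sum_chi_chi {m : ℕ} (x y : Fin m → Bool) :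
    ∑ S, chi S x * chi S y = if x = y then (2 : ℝ) ^ m else 0 := by
  have h : ∀ S : Finset (Fin m), chi S x * chi S y =
      ∏ i ∈ S, ((if x i then (-1 : ℝ) else 1) * (if y i then (-1 : ℝ) else 1)) := by
    intro S
    unfold chi
    rw [Finset.prod_mul_distrib]
  simp_rw [h]
  rw [← Finset.powerset_univ, ← Finset.prod_one_add]
  split_ifs with hxy
  · subst hxy
    have : ∀ i, (1 + (if x i then (-1 : ℝ) else 1) * (if x i then (-1 : ℝ) else 1)) = 2 := by
      intro i
      cases x i <;> norm_num
    simp_rw [this]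
    simp
  · obtain ⟨i, hi⟩ := Function.ne_iff.mp hxy
    apply Finset.prod_eq_zero (Finset.mem_univ i)
    revert hi
    cases x i <;> cases y i <;> simp

/-- One-variable Parseval, unnormalised. -/
lemma parseval_one {m : ℕ} (f : (Fin m → Bool) → ℝ) :
    ∑ S, (∑ x, f x * chi S x) ^ 2 = 2 ^ m * ∑ x, f x ^ 2 := by
  calc ∑ S, (∑ x, f x * chi S x) ^ 2
      = ∑ S, ∑ x, ∑ y, f x * f y * (chi S x * chi S y) := by
        refine Finset.sum_congr rfl fun S _ => ?_
        rw [sq, Finset.sum_mul_sum]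
        refine Finset.sum_congr rfl fun x _ => Finset.sum_congr rfl fun y _ => ?_
        ring
    _ = ∑ x, ∑ y, f x * f y * ∑ S, chi S x * chi S y := by
        rw [Finset.sum_comm]
        refine Finset.sum_congr rfl fun x _ => ?_
        rw [Finset.sum_comm]
        refine Finset.sum_congr rfl fun y _ => ?_
        rw [Finset.mul_sum]
    _ = 2 ^ m * ∑ x, f x ^ 2 := by
        simp_rw [sum_chi_chi, mul_ite, mul_zero]
        simp only [Finset.sum_ite_eq, Finset.mem_univ, if_true]
        rw [Finset.mul_sum]
        refine Finset.sum_congr rfl fun x _ => ?_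
        ring

lemma parseval_two {m₁ m₂ : ℕ} (h : (Fin m₁ → Bool) → (Fin m₂ → Bool) → ℝ) :
    ∑ S, ∑ T, (fcoef h S T) ^ 2 = (1 / 2 ^ (m₁ + m₂) : ℝ) * ∑ x, ∑ y, h x y ^ 2 := by
  have h1 : ∀ S T, (fcoef h S T) ^ 2 = (1 / 2 ^ (m₁ + m₂) : ℝ) ^ 2 *
      (∑ y, (∑ x, h x y * chi S x) * chi T y) ^ 2 := by
    intro S T
    unfold fcoef
    rw [mul_pow, Finset.sum_comm]
    simp_rw [Finset.sum_mul]
  simp_rw [h1, ← Finset.mul_sum, parseval_one]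
  rw [← Finset.mul_sum, Finset.sum_comm]
  simp_rw [parseval_one]
  rw [← Finset.mul_sum, Finset.sum_comm (s := (Finset.univ : Finset (Fin m₂ → Bool)))]
  have : (2 : ℝ) ^ (m₁ + m₂) ≠ 0 := by positivity
  field_simp
  rw [pow_add]
  ring

lemma fcoef_noisyX {m₁ m₂ : ℕ} (p : ℝ) (h : (Fin m₁ → Bool) → (Fin m₂ → Bool) → ℝ)
    (S : Finset (Fin m₁)) (T : Finset (Fin m₂)) :
    fcoef (noisyX p h) S T = (1 - 2 * p) ^ S.card * fcoef h S T := by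
  have key : ∀ y, ∑ x, noisyX p h x y * chi S x * chi T y =
      (1 - 2 * p) ^ S.card * ∑ x, h x y * chi S x * chi T y := by
    intro y
    unfold noisyX
    simp_rw [Finset.sum_mul]
    rw [Finset.sum_comm, ← sum_bern_chi, Finset.sum_mul]
    refine Finset.sum_congr rfl fun z _ => ?_
    rw [← sum_xor_shift z (fun x => h x y * chi S x * chi T y), Finset.mul_sum]
    refine Finset.sum_congr rfl fun x _ => ?_
    have hz : chi S z * chi S z = 1 := by
      unfold chi
      rw [← Finset.prod_mul_distrib]
      refine Finset.prod_eq_one fun i _ => ?_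
      cases z i <;> simp
    simp only [chi_xor]
    linear_combination (-(bern p z * h (fun i => xor (x i) (z i)) y * chi S x * chi T y)) * hz
  unfold fcoef
  rw [Finset.sum_comm]
  simp_rw [key]
  rw [← Finset.mul_sum, Finset.sum_comm]
  ring

lemma noisyX_adjoint {m₁ m₂ : ℕ} (p : ℝ) (f g : (Fin m₁ → Bool) → (Fin m₂ → Bool) → ℝ) :
    ∑ x, ∑ y, f x y * noisyX p g x y = ∑ x, ∑ y, noisyX p f x y * g x y := by
  rw [Finset.sum_comm, Finset.sum_comm (γ := Fin m₁ → Bool) (α := Fin m₂ → Bool)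
    (f := fun x y => noisyX p f x y * g x y)]
  refine Finset.sum_congr rfl fun y _ => ?_
  unfold noisyX
  simp_rw [Finset.mul_sum, Finset.sum_mul]
  rw [Finset.sum_comm]
  conv_rhs => rw [Finset.sum_comm]
  refine Finset.sum_congr rfl fun z _ => ?_
  rw [← sum_xor_shift z (fun x => bern p z * f (fun i => xor (x i) (z i)) y * g x y)]
  refine Finset.sum_congr rfl fun x _ => ?_
  simp only [Bool.xor_assoc, Bool.xor_self, Bool.xor_false]
  ring

/-- **Correlation forces weighted Fourier mass.**
Let `p ∈ (0, 1/2)`, `ρ := 1 − 2p`, `F₀, G₀ : {0,1}^{m₁} × {0,1}^{m₂} → [−1,1]`,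
`F := noisyY p F₀`, `G := noisyX p G₀`.  If `E_{(X,Y) uniform}[F·G] ≥ δ > 0`,
then `∑_{S,T} ρ^{|S|} F̂(S,T)² ≥ δ²`. -/
theorem stmt7 (m₁ m₂ : ℕ) (hm₁ : 1 ≤ m₁) (hm₂ : 1 ≤ m₂)
    (p : ℝ) (hp0 : 0 < p) (hp1 : p < 1 / 2)
    (F0 G0 : (Fin m₁ → Bool) → (Fin m₂ → Bool) → ℝ)
    (hF0 : ∀ x y, |F0 x y| ≤ 1) (hG0 : ∀ x y, |G0 x y| ≤ 1)
    (δ : ℝ) (hδ : 0 < δ)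
    (hcorr : δ ≤ (1 / 2 ^ (m₁ + m₂) : ℝ) *
      ∑ x : Fin m₁ → Bool, ∑ y : Fin m₂ → Bool,
        noisyY p F0 x y * noisyX p G0 x y) :
    δ ^ 2 ≤ ∑ S : Finset (Fin m₁), ∑ T : Finset (Fin m₂),
      (1 - 2 * p) ^ S.card * (fcoef (noisyY p F0) S T) ^ 2 := by
  set F := noisyY p F0 with hF
  set N : ℝ := 1 / 2 ^ (m₁ + m₂) with hN
  have hNpos : 0 < N := by positivity
  rw [noisyX_adjoint] at hcorr
  set H := noisyX p F with hH
  have hNcard : N * ∑ _x : Fin m₁ → Bool, ∑ _y : Fin m₂ → Bool, (1 : ℝ) = 1 := by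
    simp [hN, pow_add]
    field_simp
  -- second moment bound: 2 δ H G0 ≤ H ^ 2 + δ ^ 2
  have hpt : ∀ x y, 2 * δ * (H x y * G0 x y) ≤ H x y ^ 2 + δ ^ 2 * 1 := by
    intro x y
    have hg : G0 x y ^ 2 ≤ 1 := (sq_le_one_iff_abs_le_one _).mpr (hG0 x y)
    nlinarith [sq_nonneg (H x y - δ * G0 x y), mul_le_mul_of_nonneg_left hg (sq_nonneg δ)]
  have hsum : 2 * δ * (N * ∑ x, ∑ y, H x y * G0 x y) ≤ N * ∑ x, ∑ y, H x y ^ 2 + δ ^ 2 := by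
    have h1 : ∑ x, ∑ y, 2 * δ * (H x y * G0 x y) ≤ ∑ x, ∑ y, (H x y ^ 2 + δ ^ 2 * 1) :=
      Finset.sum_le_sum fun x _ => Finset.sum_le_sum fun y _ => hpt x y
    simp_rw [Finset.sum_add_distrib, ← Finset.mul_sum] at h1
    have h2 := mul_le_mul_of_nonneg_left h1 hNpos.le
    linear_combination h2 + δ ^ 2 * hNcard
  have hmain : δ ^ 2 ≤ N * ∑ x, ∑ y, H x y ^ 2 := by
    nlinarith [mul_le_mul_of_nonneg_left hcorr hδ.le]
  rw [hN, ← parseval_two] at hmain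
  refine hmain.trans (Finset.sum_le_sum fun S _ => Finset.sum_le_sum fun T _ => ?_)
  rw [hH, fcoef_noisyX, mul_pow]
  refine mul_le_mul_of_nonneg_right ?_ (sq_nonneg _)
  have h0 : 0 ≤ (1 - 2 * p) ^ S.card := pow_nonneg (by linarith) _
  have h1 : (1 - 2 * p) ^ S.card ≤ 1 := pow_le_one₀ (by linarith) (by linarith)
  nlinarith
end

section
/- (Expectation and variance of the split-sample low-degree score) Let (X,Y) be uniform on {0,1}^{m_1} × {0,1}^{m_2}, let K ∈ {−1,+1} be a random variable with E[K | X=x, Y=y] = F(x,y), and let 𝓛 be a fixed family of pairs (S,T) with S ⊆ [m_1], T ⊆ [m_2] and |𝓛| = M. Draw two independent blocks of m i.i.d. samples (X_i^{(r)}, Y_i^{(r)}, K_i^{(r)}), i ∈ [m], r ∈ {1,2}, from the joint law of (X,Y,K), and set ĉ^{(r)}_{S,T} := (1/m)·∑_{i=1}^m K_i^{(r)} χ_S(X_i^{(r)}) χ_T(Y_i^{(r)}) and Score := ∑_{(S,T)∈𝓛} ĉ^{(1)}_{S,T} · ĉ^{(2)}_{S,T}. Then: (i) E[Score] = ∑_{(S,T)∈𝓛}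 F̂(S,T)²; (ii) Var(Score) ≤ 2·(∑_{(S,T)∈𝓛} F̂(S,T)²)·(M/m) + (M/m)² ≤ 2M/m + (M/m)². Moreover, if instead K is a uniform ±1 bit independent of (X,Y), then E[Score] = 0 and E[Score²] ≤ (M/m)². -/
open Finset

/-- A single sample `(x, y, k)` with `k ∈ {−1,+1}` encoded as a `Bool`
(`true ↔ +1`). -/
abbrev Samp (m₁ m₂ : ℕ) := (Fin m₁ → Bool) × (Fin m₂ → Bool) × Bool

/-- The weight of a single sample when `(X,Y)` is uniform and
`E[K | X = x, Y = y] = F(x,y)` (so `Pr[K = +1 | x, y] = (1 + F(x,y))/2`). -/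
noncomputable def sampW {m₁ m₂ : ℕ} (F : (Fin m₁ → Bool) → (Fin m₂ → Bool) → ℝ)
    (s : Samp m₁ m₂) : ℝ :=
  (1 / 2 ^ (m₁ + m₂) : ℝ) *
    (if s.2.2 then (1 + F s.1 s.2.1) / 2 else (1 - F s.1 s.2.1) / 2)

/-- The weight of a single sample when `(X,Y)` is uniform and `K` is a uniform
`±1` bit independent of `(X,Y)` (the null distribution). -/
noncomputable def nullW {m₁ m₂ : ℕ} (_ : Samp m₁ m₂) : ℝ :=
  (1 / 2 ^ (m₁ + m₂) : ℝ) * (1 / 2)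

/-- The i.i.d. product weight of two independent blocks of `m` samples. -/
noncomputable def blockW {m₁ m₂ m : ℕ} (w : Samp m₁ m₂ → ℝ)
    (ω : Fin 2 → Fin m → Samp m₁ m₂) : ℝ :=
  ∏ r : Fin 2, ∏ i : Fin m, w (ω r i)

/-- The empirical coefficient
`ĉ^{(r)}_{S,T} = (1/m) ∑_i K_i^{(r)} χ_S(X_i^{(r)}) χ_T(Y_i^{(r)})`. -/
noncomputable def chat {m₁ m₂ m : ℕ} (S : Finset (Fin m₁)) (T : Finset (Fin m₂))
    (r : Fin 2) (ω : Fin 2 → Fin m → Samp m₁ m₂) : ℝ :=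
  (1 / m : ℝ) * ∑ i : Fin m,
    (if (ω r i).2.2 then (1 : ℝ) else -1) * chi S (ω r i).1 * chi T (ω r i).2.1

/-- The split-sample low-degree score
`Score = ∑_{(S,T) ∈ 𝓛} ĉ^{(1)}_{S,T} · ĉ^{(2)}_{S,T}`. -/
noncomputable def score {m₁ m₂ m : ℕ}
    (𝓛 : Finset (Finset (Fin m₁) × Finset (Fin m₂)))
    (ω : Fin 2 → Fin m → Samp m₁ m₂) : ℝ :=
  ∑ st ∈ 𝓛, chat st.1 st.2 0 ω * chat st.1 st.2 1 ω

lemma chi_orth {n : ℕ} (S S' : Finset (Fin n)) :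
    ∑ x : Fin n → Bool, chi S x * chi S' x = if S = S' then (2:ℝ)^n else 0 := by
  have h1 : ∀ x : Fin n → Bool, chi S x * chi S' x =
      ∏ i, ((if i ∈ S then (if x i then (-1:ℝ) else 1) else 1) *
        (if i ∈ S' then (if x i then (-1:ℝ) else 1) else 1)) := by
    intro x
    rw [Finset.prod_mul_distrib]
    simp [chi, Finset.prod_ite_mem]
  simp_rw [h1]
  rw [← Fintype.prod_sum (fun (i : Fin n) (b : Bool) =>
      ((if i ∈ S then (if b then (-1:ℝ) else 1) else 1) *
        (if i ∈ S' then (if b then (-1:ℝ) else 1) else 1)))]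
  split_ifs with h
  · subst h
    have : ∀ i : Fin n, ∑ b : Bool, ((if i ∈ S then (if b then (-1:ℝ) else 1) else 1) *
        (if i ∈ S then (if b then (-1:ℝ) else 1) else 1)) = 2 := by
      intro i
      by_cases hi : i ∈ S <;> simp [hi] <;> norm_num
    rw [Finset.prod_congr rfl fun i _ => this i]
    simp
  · have : ∃ i, ¬ (i ∈ S ↔ i ∈ S') := by
      by_contra hc
      push Not at hc
      exact h (Finset.ext hc)
    obtain ⟨i, hi⟩ := this
    apply Finset.prod_eq_zero (Finset.mem_univ i)
    by_cases h1 : i ∈ S <;> by_cases h2 : i ∈ S' <;> simp_all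

/-- Signed character of a sample. -/
noncomputable def sfun {m₁ m₂ : ℕ} (p : Finset (Fin m₁) × Finset (Fin m₂))
    (s : Samp m₁ m₂) : ℝ :=
  (if s.2.2 then (1 : ℝ) else -1) * chi p.1 s.1 * chi p.2 s.2.1

lemma sampW_nonneg {m₁ m₂ : ℕ} (F : (Fin m₁ → Bool) → (Fin m₂ → Bool) → ℝ)
    (hF : ∀ x y, |F x y| ≤ 1) (s : Samp m₁ m₂) : 0 ≤ sampW F s := by
  have := abs_le.mp (hF s.1 s.2.1)
  unfold sampW
  apply mul_nonneg (by positivity)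
  split_ifs <;> linarith

lemma sampW_sum {m₁ m₂ : ℕ} (F : (Fin m₁ → Bool) → (Fin m₂ → Bool) → ℝ) :
    ∑ s, sampW F s = 1 := by
  have : ∀ x y, sampW F (x, y, true) + sampW F (x, y, false) = 1 / 2 ^ (m₁ + m₂) := by
    intro x y; simp [sampW]; ring
  simp [Fintype.sum_prod_type, this, pow_add]

lemma sampW_mean {m₁ m₂ : ℕ} (F : (Fin m₁ → Bool) → (Fin m₂ → Bool) → ℝ)
    (p : Finset (Fin m₁) × Finset (Fin m₂)) :
    ∑ s, sampW F s * sfun p s = fcoef F p.1 p.2 := by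
  have : ∀ x y, sampW F (x, y, true) * sfun p (x, y, true) +
      sampW F (x, y, false) * sfun p (x, y, false)
      = 1 / 2 ^ (m₁ + m₂) * (F x y * chi p.1 x * chi p.2 y) := by
    intro x y; simp [sampW, sfun]; ring
  simp only [Fintype.sum_prod_type, Fintype.sum_bool, this, fcoef, Finset.mul_sum]

lemma sampW_orth {m₁ m₂ : ℕ} (F : (Fin m₁ → Bool) → (Fin m₂ → Bool) → ℝ)
    (p q : Finset (Fin m₁) × Finset (Fin m₂)) :
    ∑ s, sampW F s * (sfun p s * sfun q s) = if p = q then 1 else 0 := by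
  have : ∀ x y, sampW F (x, y, true) * (sfun p (x, y, true) * sfun q (x, y, true)) +
      sampW F (x, y, false) * (sfun p (x, y, false) * sfun q (x, y, false))
      = 1 / 2 ^ (m₁ + m₂) * ((chi p.1 x * chi q.1 x) * (chi p.2 y * chi q.2 y)) := by
    intro x y; simp [sampW, sfun]; ring
  simp only [Fintype.sum_prod_type, Fintype.sum_bool, this, ← Finset.mul_sum, ← Finset.sum_mul,
    chi_orth]
  by_cases h1 : p.1 = q.1 <;> by_cases h2 : p.2 = q.2 <;> simp [h1, h2, Prod.ext_iff, pow_add]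
  field_simp

section block
variable {Ω : Type*} [Fintype Ω] {m : ℕ} (w : Ω → ℝ)

lemma block_one (hw : ∑ s, w s = 1) (f : Ω → ℝ) (i : Fin m) :
    ∑ v : Fin m → Ω, (∏ k, w (v k)) * f (v i) = ∑ s, w s * f s := by
  have h1 : ∀ v : Fin m → Ω, (∏ k, w (v k)) * f (v i) =
      ∏ k, (w (v k) * (if k = i then f (v k) else 1)) := by
    intro v
    rw [Finset.prod_mul_distrib]; simp
  simp_rw [h1]
  classical
  rw [← Fintype.prod_sum (fun (k : Fin m) (s : Ω) => w s * (if k = i then f s else 1)),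
    Finset.prod_eq_single i]
  · simp
  · intro b _ hb; simp [hb, hw]
  · simp

lemma block_two (hw : ∑ s, w s = 1) (f g : Ω → ℝ) (i j : Fin m) (hij : i ≠ j) :
    ∑ v : Fin m → Ω, (∏ k, w (v k)) * (f (v i) * g (v j)) =
      (∑ s, w s * f s) * (∑ s, w s * g s) := by
  have h1 : ∀ v : Fin m → Ω, (∏ k, w (v k)) * (f (v i) * g (v j)) =
      ∏ k, (w (v k) * ((if k = i then f (v k) else 1) * (if k = j then g (v k) else 1))) := by
    intro v
    rw [Finset.prod_mul_distrib, Finset.prod_mul_distrib]; simp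
  simp_rw [h1]
  classical
  rw [← Fintype.prod_sum (fun (k : Fin m) (s : Ω) =>
      w s * ((if k = i then f s else 1) * (if k = j then g s else 1))),
    Finset.prod_eq_mul i j hij]
  · simp [hij, hij.symm]
  · intro b _ hb; simp [hb.1, hb.2, hw]
  · simp
  · simp

lemma block_mean (hm : 1 ≤ m) (hw : ∑ s, w s = 1) (f : Ω → ℝ) :
    ∑ v : Fin m → Ω, (∏ k, w (v k)) * ((1 / m : ℝ) * ∑ i, f (v i)) = ∑ s, w s * f s := by
  have hm' : (m:ℝ) ≠ 0 := by positivity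
  have : ∀ v : Fin m → Ω, (∏ k, w (v k)) * ((1 / m : ℝ) * ∑ i, f (v i)) =
      (1 / m : ℝ) * ∑ i, (∏ k, w (v k)) * f (v i) := by
    intro v; rw [← Finset.mul_sum]; ring
  simp_rw [this]
  rw [← Finset.mul_sum, Finset.sum_comm]
  simp_rw [block_one w hw]
  simp [hm']

lemma block_second (hm : 1 ≤ m) (hw : ∑ s, w s = 1) (f g : Ω → ℝ) :
    ∑ v : Fin m → Ω, (∏ k, w (v k)) *
        (((1 / m : ℝ) * ∑ i, f (v i)) * ((1 / m : ℝ) * ∑ i, g (v i))) =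
      (1 - 1 / m) * ((∑ s, w s * f s) * (∑ s, w s * g s)) +
      (1 / m) * ∑ s, w s * (f s * g s) := by
  have hm' : (m:ℝ) ≠ 0 := by positivity
  have : ∀ v : Fin m → Ω, (∏ k, w (v k)) *
        (((1 / m : ℝ) * ∑ i, f (v i)) * ((1 / m : ℝ) * ∑ i, g (v i))) =
      (1 / m : ℝ)^2 * ∑ i, ∑ j, (∏ k, w (v k)) * (f (v i) * g (v j)) := by
    intro v
    simp_rw [← Finset.mul_sum, ← Finset.sum_mul]; ring
  simp_rw [this]
  rw [← Finset.mul_sum, Finset.sum_comm]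
  have h2 : ∀ i : Fin m, ∑ v : Fin m → Ω, ∑ j, (∏ k, w (v k)) * (f (v i) * g (v j)) =
      (m - 1) * ((∑ s, w s * f s) * (∑ s, w s * g s)) + ∑ s, w s * (f s * g s) := by
    intro i
    rw [Finset.sum_comm]
    have h3 : ∀ j : Fin m, ∑ v : Fin m → Ω, (∏ k, w (v k)) * (f (v i) * g (v j)) =
        (∑ s, w s * f s) * (∑ s, w s * g s) +
        if i = j then (∑ s, w s * (f s * g s)) - (∑ s, w s * f s) * (∑ s, w s * g s) else 0 := by
      intro j
      by_cases hij : i = j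
      · subst hij
        simp [block_one w hw (fun s => f s * g s) i]
      · simp [hij, block_two w hw f g i j hij]
    simp_rw [h3]
    rw [Finset.sum_add_distrib]
    simp
    ring
  simp_rw [h2]
  simp
  field_simp

lemma two_blocks (g h : (Fin m → Ω) → ℝ) :
    ∑ ω : Fin 2 → Fin m → Ω, (∏ r : Fin 2, ∏ i, w (ω r i)) * (g (ω 0) * h (ω 1)) =
      (∑ v : Fin m → Ω, (∏ i, w (v i)) * g v) * (∑ v : Fin m → Ω, (∏ i, w (v i)) * h v) := by
  rw [Finset.sum_mul_sum, ← Fintype.sum_prod_type',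
    ← (piFinTwoEquiv (fun _ => Fin m → Ω)).sum_comp]
  refine Finset.sum_congr rfl fun ω _ => ?_
  simp [Fin.prod_univ_two]
  ring
end block

lemma chat_eq {m₁ m₂ m : ℕ} (p : Finset (Fin m₁) × Finset (Fin m₂)) (r : Fin 2)
    (ω : Fin 2 → Fin m → Samp m₁ m₂) :
    chat p.1 p.2 r ω = (1 / m : ℝ) * ∑ i, sfun p (ω r i) := rfl

lemma score_mean {m₁ m₂ m : ℕ} (hm : 1 ≤ m) (F : (Fin m₁ → Bool) → (Fin m₂ → Bool) → ℝ)
    (L : Finset (Finset (Fin m₁) × Finset (Fin m₂))) :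
    ∑ ω : Fin 2 → Fin m → Samp m₁ m₂, blockW (sampW F) ω * score L ω
        = ∑ st ∈ L, (fcoef F st.1 st.2) ^ 2 := by
  simp_rw [score, Finset.mul_sum]
  rw [Finset.sum_comm]
  refine Finset.sum_congr rfl fun p _ => ?_
  simp_rw [chat_eq, blockW]
  rw [two_blocks (sampW F) (fun v => (1 / m : ℝ) * ∑ i, sfun p (v i))
    (fun v => (1 / m : ℝ) * ∑ i, sfun p (v i)), block_mean _ hm (sampW_sum F), sampW_mean, sq]

lemma score_second {m₁ m₂ m : ℕ} (hm : 1 ≤ m) (F : (Fin m₁ → Bool) → (Fin m₂ → Bool) → ℝ)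
    (L : Finset (Finset (Fin m₁) × Finset (Fin m₂))) :
    ∑ ω : Fin 2 → Fin m → Samp m₁ m₂, blockW (sampW F) ω * (score L ω)^2
        = ∑ p ∈ L, ∑ q ∈ L, ((1 - 1 / m) * (fcoef F p.1 p.2 * fcoef F q.1 q.2) +
          (1 / m) * if p = q then 1 else 0) ^ 2 := by
  have h1 : ∀ ω : Fin 2 → Fin m → Samp m₁ m₂, blockW (sampW F) ω * (score L ω)^2 =
      ∑ p ∈ L, ∑ q ∈ L, blockW (sampW F) ω * ((chat p.1 p.2 0 ω * chat q.1 q.2 0 ω) *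
        (chat p.1 p.2 1 ω * chat q.1 q.2 1 ω)) := by
    intro ω
    rw [score, sq, Finset.sum_mul_sum, Finset.mul_sum]
    refine Finset.sum_congr rfl fun p _ => ?_
    rw [Finset.mul_sum]
    refine Finset.sum_congr rfl fun q _ => ?_
    ring
  simp_rw [h1]
  rw [Finset.sum_comm]
  refine Finset.sum_congr rfl fun p _ => ?_
  rw [Finset.sum_comm]
  refine Finset.sum_congr rfl fun q _ => ?_
  simp_rw [chat_eq, blockW]
  rw [two_blocks (sampW F)
    (fun v => ((1 / m : ℝ) * ∑ i, sfun p (v i)) * ((1 / m : ℝ) * ∑ i, sfun q (v i)))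
    (fun v => ((1 / m : ℝ) * ∑ i, sfun p (v i)) * ((1 / m : ℝ) * ∑ i, sfun q (v i))),
    block_second _ hm (sampW_sum F), sampW_mean, sampW_mean, sampW_orth, sq]

lemma score_second' {m₁ m₂ m : ℕ} (hm : 1 ≤ m) (F : (Fin m₁ → Bool) → (Fin m₂ → Bool) → ℝ)
    (L : Finset (Finset (Fin m₁) × Finset (Fin m₂))) :
    ∑ ω : Fin 2 → Fin m → Samp m₁ m₂, blockW (sampW F) ω * (score L ω)^2
        = (1 - 1 / m) ^ 2 * (∑ p ∈ L, (fcoef F p.1 p.2) ^ 2) ^ 2 +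
          2 * (1 - 1 / m) * (1 / m) * (∑ p ∈ L, (fcoef F p.1 p.2) ^ 2) +
          (1 / m) ^ 2 * L.card := by
  rw [score_second hm]
  have h : ∀ p ∈ L, ∑ q ∈ L, ((1 - 1 / m) * (fcoef F p.1 p.2 * fcoef F q.1 q.2) +
          (1 / m) * if p = q then (1:ℝ) else 0) ^ 2 =
      (1 - 1 / m) ^ 2 * ((fcoef F p.1 p.2) ^ 2 * ∑ q ∈ L, (fcoef F q.1 q.2) ^ 2) +
      2 * (1 - 1 / m) * (1 / m) * (fcoef F p.1 p.2) ^ 2 + (1 / m) ^ 2 := by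
    intro p hp
    have h2 : ∀ q ∈ L, ((1 - 1 / m) * (fcoef F p.1 p.2 * fcoef F q.1 q.2) +
          (1 / m) * if p = q then (1:ℝ) else 0) ^ 2 =
        (1 - 1 / m) ^ 2 * ((fcoef F p.1 p.2) ^ 2 * (fcoef F q.1 q.2) ^ 2) +
        if p = q then 2 * (1 - 1 / m) * (1 / m) * (fcoef F p.1 p.2) ^ 2 + (1 / m) ^ 2
          else 0 := by
      intro q _
      by_cases hpq : p = q
      · subst hpq; simp; ring
      · simp [hpq]; ring
    rw [Finset.sum_congr rfl h2, Finset.sum_add_distrib, Finset.sum_ite_eq, if_pos hp,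
      ← Finset.mul_sum, ← Finset.mul_sum]
    ring
  rw [Finset.sum_congr rfl h, Finset.sum_add_distrib, Finset.sum_add_distrib,
    ← Finset.mul_sum, ← Finset.mul_sum, ← Finset.sum_mul]
  simp
  ring

lemma bessel {m₁ m₂ : ℕ} (F : (Fin m₁ → Bool) → (Fin m₂ → Bool) → ℝ)
    (hF : ∀ x y, |F x y| ≤ 1) (L : Finset (Finset (Fin m₁) × Finset (Fin m₂))) :
    ∑ p ∈ L, (fcoef F p.1 p.2) ^ 2 ≤ 1 := by
  have h0 : 0 ≤ ∑ s, sampW F s * (1 - ∑ p ∈ L, fcoef F p.1 p.2 * sfun p s) ^ 2 :=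
    Finset.sum_nonneg fun s _ => mul_nonneg (sampW_nonneg F hF s) (sq_nonneg _)
  have h1 : ∀ s, sampW F s * (1 - ∑ p ∈ L, fcoef F p.1 p.2 * sfun p s) ^ 2 =
      sampW F s - 2 * (∑ p ∈ L, fcoef F p.1 p.2 * (sampW F s * sfun p s)) +
      ∑ p ∈ L, ∑ q ∈ L, (fcoef F p.1 p.2 * fcoef F q.1 q.2) *
        (sampW F s * (sfun p s * sfun q s)) := by
    intro s
    have e1 : ∑ p ∈ L, fcoef F p.1 p.2 * (sampW F s * sfun p s) =
        sampW F s * ∑ p ∈ L, fcoef F p.1 p.2 * sfun p s := by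
      rw [Finset.mul_sum]; exact Finset.sum_congr rfl fun p _ => by ring
    have e2 : ∑ p ∈ L, ∑ q ∈ L, (fcoef F p.1 p.2 * fcoef F q.1 q.2) *
        (sampW F s * (sfun p s * sfun q s)) =
        sampW F s * (∑ p ∈ L, fcoef F p.1 p.2 * sfun p s) ^ 2 := by
      rw [sq, Finset.sum_mul_sum, Finset.mul_sum]
      refine Finset.sum_congr rfl fun p _ => ?_
      rw [Finset.mul_sum]
      exact Finset.sum_congr rfl fun q _ => by ring
    rw [e1, e2]; ring
  have e3 : ∑ s, ∑ p ∈ L, fcoef F p.1 p.2 * (sampW F s * sfun p s) =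
      ∑ p ∈ L, (fcoef F p.1 p.2) ^ 2 := by
    rw [Finset.sum_comm]
    refine Finset.sum_congr rfl fun p _ => ?_
    rw [← Finset.mul_sum, sampW_mean, sq]
  have e4 : ∑ s, ∑ p ∈ L, ∑ q ∈ L, (fcoef F p.1 p.2 * fcoef F q.1 q.2) *
        (sampW F s * (sfun p s * sfun q s)) = ∑ p ∈ L, (fcoef F p.1 p.2) ^ 2 := by
    rw [Finset.sum_comm]
    refine Finset.sum_congr rfl fun p hp => ?_
    rw [Finset.sum_comm]
    simp_rw [← Finset.mul_sum, sampW_orth]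
    simp [hp, sq]
  simp_rw [h1] at h0
  rw [Finset.sum_add_distrib, Finset.sum_sub_distrib, ← Finset.mul_sum, e3, e4, sampW_sum] at h0
  linarith

lemma score_var {m₁ m₂ m : ℕ} (hm : 1 ≤ m) (F : (Fin m₁ → Bool) → (Fin m₂ → Bool) → ℝ)
    (L : Finset (Finset (Fin m₁) × Finset (Fin m₂))) :
    (∑ ω : Fin 2 → Fin m → Samp m₁ m₂, blockW (sampW F) ω * (score L ω) ^ 2)
          - (∑ ω : Fin 2 → Fin m → Samp m₁ m₂, blockW (sampW F) ω * score L ω) ^ 2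
        ≤ 2 * (∑ st ∈ L, (fcoef F st.1 st.2) ^ 2) * ((L.card : ℝ) / m)
            + ((L.card : ℝ) / m) ^ 2 := by
  rw [score_second' hm, score_mean hm]
  rcases L.eq_empty_or_nonempty with rfl | hL
  · simp
  have hM : (1:ℝ) ≤ L.card := by exact_mod_cast hL.card_pos
  have ha : 0 ≤ ∑ st ∈ L, (fcoef F st.1 st.2) ^ 2 := Finset.sum_nonneg fun _ _ => sq_nonneg _
  generalize (∑ st ∈ L, (fcoef F st.1 st.2) ^ 2) = a at *
  have hm' : (1:ℝ) ≤ m := by exact_mod_cast hm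
  have ht0 : 0 ≤ 1 / (m:ℝ) := by positivity
  have ht1 : 1 / (m:ℝ) ≤ 1 := by rw [div_le_one (by positivity)]; exact hm'
  rw [div_eq_mul_one_div (L.card : ℝ)]
  generalize 1 / (m:ℝ) = t at *
  generalize (L.card : ℝ) = M at *
  have k1 : (1 - t) ^ 2 * a ^ 2 ≤ a ^ 2 := by
    have : (1 - t) ^ 2 ≤ 1 := by nlinarith
    nlinarith [sq_nonneg a]
  have k2 : 2 * (1 - t) * t * a ≤ 2 * a * (M * t) := by
    have : 0 ≤ t * a := mul_nonneg ht0 ha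
    nlinarith
  have k3 : t ^ 2 * M ≤ (M * t) ^ 2 := by
    have : 0 ≤ t ^ 2 := sq_nonneg t
    have : M ≤ M ^ 2 := by nlinarith
    nlinarith
  linarith

lemma nullW_eq {m₁ m₂ : ℕ} : (nullW : Samp m₁ m₂ → ℝ) = sampW (fun _ _ => 0) := by
  funext s
  simp [nullW, sampW]

/-- **Expectation and variance of the split-sample low-degree score.**
With `(X,Y)` uniform, `K ∈ {−1,+1}` with `E[K | X, Y] = F(X,Y)`, and two
independent blocks of `m` i.i.d. samples:
(i) `E[Score] = ∑_{(S,T) ∈ 𝓛} F̂(S,T)²`;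
(ii) `Var(Score) ≤ 2·(∑_{(S,T)∈𝓛} F̂(S,T)²)·(M/m) + (M/m)² ≤ 2M/m + (M/m)²`;
(iii) if instead `K` is a uniform `±1` bit independent of `(X,Y)`, then
`E[Score] = 0` and `E[Score²] ≤ (M/m)²`, where `M = |𝓛|`. -/
theorem stmt9 (m₁ m₂ m : ℕ) (hm : 1 ≤ m)
    (F : (Fin m₁ → Bool) → (Fin m₂ → Bool) → ℝ) (hF : ∀ x y, |F x y| ≤ 1)
    (𝓛 : Finset (Finset (Fin m₁) × Finset (Fin m₂))) :
    (∑ ω : Fin 2 → Fin m → Samp m₁ m₂, blockW (sampW F) ω * score 𝓛 ω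
        = ∑ st ∈ 𝓛, (fcoef F st.1 st.2) ^ 2)
    ∧ ((∑ ω : Fin 2 → Fin m → Samp m₁ m₂, blockW (sampW F) ω * (score 𝓛 ω) ^ 2)
          - (∑ ω : Fin 2 → Fin m → Samp m₁ m₂, blockW (sampW F) ω * score 𝓛 ω) ^ 2
        ≤ 2 * (∑ st ∈ 𝓛, (fcoef F st.1 st.2) ^ 2) * ((𝓛.card : ℝ) / m)
            + ((𝓛.card : ℝ) / m) ^ 2)
    ∧ (2 * (∑ st ∈ 𝓛, (fcoef F st.1 st.2) ^ 2) * ((𝓛.card : ℝ) / m)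
          + ((𝓛.card : ℝ) / m) ^ 2
        ≤ 2 * ((𝓛.card : ℝ) / m) + ((𝓛.card : ℝ) / m) ^ 2)
    ∧ (∑ ω : Fin 2 → Fin m → Samp m₁ m₂, blockW nullW ω * score 𝓛 ω = 0)
    ∧ (∑ ω : Fin 2 → Fin m → Samp m₁ m₂, blockW nullW ω * (score 𝓛 ω) ^ 2
        ≤ ((𝓛.card : ℝ) / m) ^ 2) := by
  have hz : ∀ st : Finset (Fin m₁) × Finset (Fin m₂),
      fcoef (fun _ _ => (0:ℝ)) st.1 st.2 = 0 := by intro st; simp [fcoef]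
  refine ⟨score_mean hm F 𝓛, score_var hm F 𝓛, ?_, ?_, ?_⟩
  · have := bessel F hF 𝓛
    have h2 : 0 ≤ (𝓛.card : ℝ) / m := by positivity
    nlinarith
  · rw [nullW_eq, score_mean hm]
    simp [hz]
  · have h := score_var hm (fun _ _ => 0) 𝓛
    rw [nullW_eq]
    rw [score_mean hm] at h
    simpa [hz] using h
end

section
/- (Exponentially small Bhattacharyya coefficient for sequentially controlled hypotheses) Fix n ≥ 1 and p ∈ (0,1/2), and set λ(p) := (√p + √(1−p))/√2 < 1. For each t with 0 ≤ t < n let q⁺, q⁻ assign to every prefix u ∈ {−1,+1}^t values q⁺(u), q⁻(u) ∈ [0,1] such that one of them equals p and the other lies in [1/2, 1−p]. For b ∈ {+,−}, define the sequential distribution P_b on {−1,+1}^n by P_b(y) := ∏_{t=0}^{n−1} c_b(y_{1:t}, y_{t+1}), where c_b(u, +1) = q^b(u) and c_b(u, −1) = 1 − q^b(u). Then ∑_{y∈{−1,+1}^n} √(P₊(y)·P₋(y)) ≤ λ(p)^n, and consequently the maximum a posteriori error for a uniform prior, (1/2)·∑_{y} min{P₊(y), P₋(y)}, is at most (1/2)·λ(p)^n.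 -/
/-- The sequential distribution on `{−1,+1}^n` (encoded as `Fin n → Bool`,
`true ↔ +1`) induced by conditional next-bit probabilities
`q : (t : ℕ) → (Fin t → Bool) → ℝ`:
`P(y) = ∏_{t=0}^{n−1} c(y_{1:t}, y_{t+1})` with `c(u, +1) = q(u)` and
`c(u, −1) = 1 − q(u)`, where `y_{1:t}` is the length-`t` prefix of `y`. -/
noncomputable def seqP (n : ℕ) (q : (t : ℕ) → (Fin t → Bool) → ℝ)
    (y : Fin n → Bool) : ℝ :=
  ∏ t : Fin n,
    (if y t then q t.val (fun i => y (Fin.castLE t.isLt.le i))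
     else 1 - q t.val (fun i => y (Fin.castLE t.isLt.le i)))

theorem seqP_snoc (n : ℕ) (q : (t : ℕ) → (Fin t → Bool) → ℝ) (u : Fin n → Bool) (b : Bool) :
    seqP (n + 1) q (Fin.snoc (α := fun _ => Bool) u b)
      = seqP n q u * (if b then q n u else 1 - q n u) := by
  unfold seqP
  rw [Fin.prod_univ_castSucc]
  have key : ∀ (m : ℕ) (hm : m ≤ n) (i : Fin m) (h : m ≤ n + 1),
      (Fin.snoc (α := fun _ => Bool) u b : Fin (n + 1) → Bool) (Fin.castLE h i)
        = u (Fin.castLE hm i) := by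
    intro m hm i h
    have : Fin.castLE h i = Fin.castSucc (Fin.castLE hm i) := rfl
    rw [this, Fin.snoc_castSucc]
  congr 1
  · refine Finset.prod_congr rfl fun t _ => ?_
    have h : (fun i : Fin t.castSucc.val =>
        (Fin.snoc (α := fun _ => Bool) u b : Fin (n + 1) → Bool)
          (Fin.castLE t.castSucc.isLt.le i)) = fun i => u (Fin.castLE t.isLt.le i) := by
      funext i
      exact key _ t.isLt.le i _
    rw [h, Fin.snoc_castSucc]
    rfl
  · have h : (fun i : Fin (Fin.last n).val =>
        (Fin.snoc (α := fun _ => Bool) u b : Fin (n + 1) → Bool)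
          (Fin.castLE (Fin.last n).isLt.le i)) = u := by
      funext i
      exact key n le_rfl i _
    rw [h, Fin.snoc_last]
    rfl

theorem step_bound (p q : ℝ) (hp0 : 0 < p) (hp1 : p < 1 / 2) (h1 : 1 / 2 ≤ q) (h2 : q ≤ 1 - p) :
    √(p * q) + √((1 - p) * (1 - q)) ≤ (√p + √(1 - p)) / √2 := by
  rw [Real.sqrt_mul hp0.le, Real.sqrt_mul (by linarith : (0:ℝ) ≤ 1 - p)]
  have hab : √p ≤ √(1 - p) := Real.sqrt_le_sqrt (by linarith)
  have hyx : √(1 - q) ≤ √q := Real.sqrt_le_sqrt (by linarith)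
  have ha := Real.sqrt_nonneg p
  have hx2 := Real.sq_sqrt (by linarith : (0:ℝ) ≤ q)
  have hy2 := Real.sq_sqrt (by linarith : (0:ℝ) ≤ 1 - q)
  have hs2 := Real.sq_sqrt (by norm_num : (0:ℝ) ≤ 1 / 2)
  have hs0 : 0 < √(1 / 2 : ℝ) := Real.sqrt_pos.2 (by norm_num)
  have hsx : √(1 / 2 : ℝ) ≤ √q := Real.sqrt_le_sqrt h1
  have hys : √(1 - q) ≤ √(1 / 2 : ℝ) := Real.sqrt_le_sqrt (by linarith)
  have hy0 := Real.sqrt_nonneg (1 - q)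
  have e : (√p + √(1 - p)) / √2 = (√p + √(1 - p)) * √(1 / 2) := by
    rw [div_eq_mul_inv, one_div, Real.sqrt_inv]
  rw [e]
  generalize √(1 / 2 : ℝ) = s at *
  generalize √q = x at *
  generalize √(1 - q) = y at *
  generalize √p = a at *
  generalize √(1 - p) = b at *
  have h3 : x - s ≤ s - y := by
    by_contra hc
    push Not at hc
    nlinarith
  nlinarith [mul_nonneg (sub_nonneg.2 hab) (sub_nonneg.2 hys), mul_le_mul_of_nonneg_left h3 ha]

theorem seqP_nonneg (n : ℕ) (q : (t : ℕ) → (Fin t → Bool) → ℝ)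
    (hq : ∀ t, t < n → ∀ u, 0 ≤ q t u ∧ q t u ≤ 1) (y : Fin n → Bool) : 0 ≤ seqP n q y := by
  unfold seqP
  refine Finset.prod_nonneg fun t _ => ?_
  have := hq t.val t.isLt (fun i => y (Fin.castLE t.isLt.le i))
  split_ifs <;> linarith

theorem bhatt_bound (p : ℝ) (hp0 : 0 < p) (hp1 : p < 1 / 2)
    (qp qm : (t : ℕ) → (Fin t → Bool) → ℝ) (n : ℕ)
    (hq : ∀ t, t < n → ∀ u : Fin t → Bool,
      (qp t u = p ∧ 1 / 2 ≤ qm t u ∧ qm t u ≤ 1 - p) ∨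
      (qm t u = p ∧ 1 / 2 ≤ qp t u ∧ qp t u ≤ 1 - p)) :
    ∑ y : Fin n → Bool, √(seqP n qp y * seqP n qm y) ≤ ((√p + √(1 - p)) / √2) ^ n := by
  induction n with
  | zero => simp [seqP]
  | succ n ih =>
    have hq' := fun t (ht : t < n) => hq t (by omega)
    have hP := seqP_nonneg n qp (fun t ht u => by
      rcases hq' t ht u with h | h <;> constructor <;> linarith)
    have hM := seqP_nonneg n qm (fun t ht u => by
      rcases hq' t ht u with h | h <;> constructor <;> linarith)
    rw [← (Fin.snocEquiv (fun _ : Fin (n + 1) => Bool)).sum_comp, Fintype.sum_prod_type_right,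
      pow_succ]
    have hl : 0 ≤ (√p + √(1 - p)) / √2 := by positivity
    refine le_trans ?_ (mul_le_mul_of_nonneg_right (ih hq') hl)
    rw [Finset.sum_mul]
    refine Finset.sum_le_sum fun u _ => ?_
    have hs : ∀ b : Bool, Fin.snocEquiv (fun _ : Fin (n + 1) => Bool) (b, u)
      = Fin.snoc (α := fun _ => Bool) u b := fun b => rfl
    simp only [hs, seqP_snoc, mul_mul_mul_comm, Fintype.sum_bool]
    rw [Real.sqrt_mul (mul_nonneg (hP u) (hM u)), Real.sqrt_mul (mul_nonneg (hP u) (hM u)),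
      ← mul_add]
    refine mul_le_mul_of_nonneg_left ?_ (Real.sqrt_nonneg _)
    simp only [if_true, Bool.false_eq_true, if_false]
    rcases hq n (by omega) u with ⟨h, h1, h2⟩ | ⟨h, h1, h2⟩
    · rw [h]; exact step_bound p _ hp0 hp1 h1 h2
    · rw [h, mul_comm, mul_comm (1 - qp n u)]; exact step_bound p _ hp0 hp1 h1 h2

/-- **Exponentially small Bhattacharyya coefficient for sequentially controlled
hypotheses.**  Fix `n ≥ 1`, `p ∈ (0, 1/2)`, and set
`λ(p) := (√p + √(1−p))/√2`.  Suppose that for every `t < n` and every prefix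
`u ∈ {−1,+1}^t`, one of `q⁺(u), q⁻(u)` equals `p` while the other lies in
`[1/2, 1−p]`.  Then `λ(p) < 1`,
`∑_y √(P₊(y)·P₋(y)) ≤ λ(p)^n`, and consequently the maximum a posteriori error
for a uniform prior, `(1/2)·∑_y min{P₊(y), P₋(y)}`, is at most
`(1/2)·λ(p)^n`. -/
theorem stmt12 (n : ℕ) (hn : 1 ≤ n) (p : ℝ) (hp0 : 0 < p) (hp1 : p < 1 / 2)
    (qp qm : (t : ℕ) → (Fin t → Bool) → ℝ)
    (hq : ∀ t, t < n → ∀ u : Fin t → Bool,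
      (qp t u = p ∧ 1 / 2 ≤ qm t u ∧ qm t u ≤ 1 - p) ∨
      (qm t u = p ∧ 1 / 2 ≤ qp t u ∧ qp t u ≤ 1 - p)) :
    (Real.sqrt p + Real.sqrt (1 - p)) / Real.sqrt 2 < 1
    ∧ (∑ y : Fin n → Bool, Real.sqrt (seqP n qp y * seqP n qm y)
        ≤ ((Real.sqrt p + Real.sqrt (1 - p)) / Real.sqrt 2) ^ n)
    ∧ ((1 / 2 : ℝ) * ∑ y : Fin n → Bool, min (seqP n qp y) (seqP n qm y)
        ≤ (1 / 2) * ((Real.sqrt p + Real.sqrt (1 - p)) / Real.sqrt 2) ^ n) := by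
  have hb := bhatt_bound p hp0 hp1 qp qm n hq
  refine ⟨?_, hb, ?_⟩
  · rw [div_lt_one (by positivity)]
    apply Real.lt_sqrt_of_sq_lt
    have h1 := Real.sq_sqrt hp0.le
    have h2 := Real.sq_sqrt (by linarith : (0:ℝ) ≤ 1 - p)
    have h3 : √p < √(1 - p) := Real.sqrt_lt_sqrt hp0.le (by linarith)
    nlinarith [mul_pos (sub_pos.2 h3) (sub_pos.2 h3)]
  · refine mul_le_mul_of_nonneg_left (le_trans (Finset.sum_le_sum fun y _ => ?_) hb) (by norm_num)
    have hP := seqP_nonneg n qp (fun t ht u => by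
      rcases hq t ht u with h | h <;> constructor <;> linarith) y
    have hM := seqP_nonneg n qm (fun t ht u => by
      rcases hq t ht u with h | h <;> constructor <;> linarith) y
    apply Real.le_sqrt_of_sq_le
    rw [sq]
    exact mul_le_mul (min_le_left _ _) (min_le_right _ _) (le_min hP hM) hP
end

section
/- (Correctness of the sequential majority sampler) Fix n ≥ 1 and β ≥ 0. Let σ(u) = 1/(1+e^{−u}), w(s) := 2σ(βs), and H[r,s] := E[w(s + W_r)] where W_r is the simple random walk of length r. For r ≥ 1 and s ∈ ℤ define q(r,s) := H[r−1, s+1] / (H[r−1, s+1] + H[r−1, s−1]). Let U_1, …, U_n ∈ {−1,+1} be generated sequentially by Pr[U_{t+1} = +1 | U_1, …, U_t] = q(n−t, S_t), where S_t := U_1 + ⋯ + U_t. Then the resulting joint law is exactly Pr[U = u] = 2^{−n}·w(∑_{i=1}^n u_i) for every u ∈ {−1,+1}^n; in particular, u ↦ 2^{−n}·w(∑ u_i) is a probability distribution on {−1,+1}^n. -/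
/-- The logistic function `σ(u) = 1/(1 + e^{−u})`. -/
noncomputable def sig (u : ℝ) : ℝ := 1 / (1 + Real.exp (-u))

/-- `w(s) := 2·σ(β·s)`. -/
noncomputable def wfun (β : ℝ) (s : ℤ) : ℝ := 2 * sig (β * s)

/-- `H[r,s] := E[w(s + W_r)]`, where `W_r` is the simple random walk of
length `r` (sum of `r` i.i.d. uniform `±1` steps, encoded via `Fin r → Bool`,
`true ↔ +1`). -/
noncomputable def Hrw (β : ℝ) (r : ℕ) (s : ℤ) : ℝ :=
  (1 / 2 ^ r : ℝ) *
    ∑ ξ : Fin r → Bool, wfun β (s + ∑ i, (if ξ i then (1 : ℤ) else -1))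

/-- The next-bit probability
`q(r,s) := H[r−1, s+1] / (H[r−1, s+1] + H[r−1, s−1])`. -/
noncomputable def qmaj (β : ℝ) (r : ℕ) (s : ℤ) : ℝ :=
  Hrw β (r - 1) (s + 1) / (Hrw β (r - 1) (s + 1) + Hrw β (r - 1) (s - 1))

theorem wfun_pos (β : ℝ) (s : ℤ) : 0 < wfun β s := by
  unfold wfun sig
  positivity

theorem wfun_add_neg (β : ℝ) (s : ℤ) : wfun β s + wfun β (-s) = 2 := by
  unfold wfun sig
  have h : Real.exp (β * s) * Real.exp (-(β * s)) = 1 := by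
    rw [← Real.exp_add]; simp
  push_cast
  rw [mul_neg, neg_neg]
  have h1 := Real.exp_pos (β * s)
  have h2 := Real.exp_pos (-(β * s))
  field_simp
  linear_combination -h

theorem Hrw_pos (β : ℝ) (r : ℕ) (s : ℤ) : 0 < Hrw β r s := by
  unfold Hrw
  have : 0 < ∑ ξ : Fin r → Bool, wfun β (s + ∑ i, (if ξ i then (1 : ℤ) else -1)) :=
    Finset.sum_pos (fun _ _ => wfun_pos _ _) Finset.univ_nonempty
  positivity

theorem Hrw_succ (β : ℝ) (r : ℕ) (s : ℤ) :
    Hrw β (r + 1) s = (Hrw β r (s + 1) + Hrw β r (s - 1)) / 2 := by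
  unfold Hrw
  rw [← (Fin.consEquiv (fun _ : Fin (r + 1) => Bool)).sum_comp, Fintype.sum_prod_type]
  simp only [Fin.consEquiv_apply, Fin.sum_univ_succ, Fin.cons_zero, Fin.cons_succ,
    Fintype.sum_bool, if_true, Bool.false_eq_true, if_false, ← add_assoc, ← sub_eq_add_neg]
  rw [pow_succ]
  field_simp

theorem Hrw_add_neg (β : ℝ) (r : ℕ) : ∀ s : ℤ, Hrw β r s + Hrw β r (-s) = 2 := by
  induction r with
  | zero => intro s; simpa [Hrw] using wfun_add_neg β s
  | succ r ih =>
    intro s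
    rw [Hrw_succ, Hrw_succ]
    have h1 := ih (s + 1)
    have h2 := ih (s - 1)
    rw [show -(s + 1) = -s - 1 by ring] at h1
    rw [show -(s - 1) = -s + 1 by ring] at h2
    linarith

theorem Hrw_zero (β : ℝ) (r : ℕ) : Hrw β r 0 = 1 := by
  have := Hrw_add_neg β r 0
  rw [neg_zero] at this
  linarith

theorem seq_prod (β : ℝ) (n : ℕ) : ∀ (s : ℤ) (u : Fin n → Bool),
    (∏ t : Fin n,
        (if u t then
          qmaj β (n - t.val)
            (s + ∑ i : Fin t.val, (if u (Fin.castLE t.isLt.le i) then (1 : ℤ) else -1))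
         else
          1 - qmaj β (n - t.val)
            (s + ∑ i : Fin t.val, (if u (Fin.castLE t.isLt.le i) then (1 : ℤ) else -1))))
      * Hrw β n s
        = (1 / 2 ^ n : ℝ) * wfun β (s + ∑ i : Fin n, (if u i then (1 : ℤ) else -1)) := by
  induction n with
  | zero => intro s u; simp [Hrw]
  | succ n ih =>
    intro s u
    have key := ih (s + if u 0 then (1 : ℤ) else -1) (fun i => u i.succ)
    have hc : ∀ (t : Fin n) (i : Fin t.val),
        Fin.castLE t.succ.isLt.le i.succ = (Fin.castLE t.isLt.le i).succ := by
      intro t i; rfl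
    have hz : ∀ (t : Fin n), Fin.castLE t.succ.isLt.le (0 : Fin (t.val + 1)) = 0 := by
      intro t; rfl
    have hs : ∀ t : Fin n,
        (s + ∑ i : Fin t.succ.val,
          (if u (Fin.castLE t.succ.isLt.le i) then (1 : ℤ) else -1))
        = (s + if u 0 then (1 : ℤ) else -1) + ∑ i : Fin t.val,
          (if u (Fin.castLE t.isLt.le i).succ then (1 : ℤ) else -1) := by
      intro t
      rw [add_assoc]
      congr 1
      exact Fin.sum_univ_succ (n := t.val) _
    have hn : ∀ t : Fin n, n + 1 - t.succ.val = n - t.val := by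
      intro t; simp
    rw [Fin.prod_univ_succ]
    simp only [hs, hn]
    rw [Fin.sum_univ_succ, ← add_assoc, pow_succ]
    have h0 : (if u 0 then qmaj β (n + 1 - (0 : Fin (n + 1)).val)
            (s + ∑ i : Fin (0 : Fin (n + 1)).val,
              (if u (Fin.castLE (0 : Fin (n + 1)).isLt.le i) then (1 : ℤ) else -1))
         else
          1 - qmaj β (n + 1 - (0 : Fin (n + 1)).val)
            (s + ∑ i : Fin (0 : Fin (n + 1)).val,
              (if u (Fin.castLE (0 : Fin (n + 1)).isLt.le i) then (1 : ℤ) else -1)))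
        * Hrw β (n + 1) s = Hrw β n (s + if u 0 then (1 : ℤ) else -1) / 2 := by
      have e : (s + ∑ i : Fin (0 : Fin (n + 1)).val,
          (if u (Fin.castLE (0 : Fin (n + 1)).isLt.le i) then (1 : ℤ) else -1)) = s := by
        have : (∑ i : Fin (0 : Fin (n + 1)).val,
          (if u (Fin.castLE (0 : Fin (n + 1)).isLt.le i) then (1 : ℤ) else -1)) = 0 :=
          Fin.sum_univ_zero _
        rw [this, add_zero]
      rw [e, Hrw_succ]
      have h1 := Hrw_pos β n (s + 1)
      have h2 := Hrw_pos β n (s - 1)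
      have hq : qmaj β (n + 1 - (0 : Fin (n + 1)).val) s
          = Hrw β n (s + 1) / (Hrw β n (s + 1) + Hrw β n (s - 1)) := by
        simp [qmaj]
      rw [hq]
      cases u 0
      · simp only [Bool.false_eq_true, if_false, ← sub_eq_add_neg]
        field_simp
        ring
      · simp only [if_true]
        field_simp
    rw [mul_right_comm, h0]
    linear_combination key / 2

/-- **Correctness of the sequential majority sampler.**
Fix `n ≥ 1` and `β ≥ 0`.  If `U₁, …, U_n ∈ {−1,+1}` are generated sequentially
with `Pr[U_{t+1} = +1 | U_1, …, U_t] = q(n − t, S_t)` (where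
`S_t = U_1 + ⋯ + U_t`), then the resulting joint law satisfies
`Pr[U = u] = 2^{−n}·w(∑_i u_i)` for every `u ∈ {−1,+1}^n` (first conjunct,
with the left-hand side written as the product of the sequential conditional
factors); in particular `u ↦ 2^{−n}·w(∑_i u_i)` is a probability distribution
on `{−1,+1}^n` (second conjunct). -/
theorem stmt14 (n : ℕ) (hn : 1 ≤ n) (β : ℝ) (hβ : 0 ≤ β) :
    (∀ u : Fin n → Bool,
      (∏ t : Fin n,
        (if u t then
          qmaj β (n - t.val)
            (∑ i : Fin t.val, (if u (Fin.castLE t.isLt.le i) then (1 : ℤ) else -1))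
         else
          1 - qmaj β (n - t.val)
            (∑ i : Fin t.val, (if u (Fin.castLE t.isLt.le i) then (1 : ℤ) else -1))))
        = (1 / 2 ^ n : ℝ) * wfun β (∑ i : Fin n, (if u i then (1 : ℤ) else -1)))
    ∧ (∑ u : Fin n → Bool,
        (1 / 2 ^ n : ℝ) * wfun β (∑ i : Fin n, (if u i then (1 : ℤ) else -1)) = 1) := by
  constructor
  · intro u
    have h := seq_prod β n 0 u
    rw [Hrw_zero, mul_one] at h
    simpa only [zero_add] using h
  · have h := Hrw_zero β n
    unfold Hrw at h
    simpa only [zero_add, Finset.mul_sum] using h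
end

section
/- (Channel-feasible biases for the majority sampler) Let p ∈ (0,1/2) and set β := (1/2)·log((1−p)/p). Then σ(2β) = 1−p and σ(−2β) = p, and consequently, with w(s) := 2σ(βs), H[r,s] := E[w(s + W_r)], and q(r,s) := H[r−1,s+1]/(H[r−1,s+1]+H[r−1,s−1]), one has q(r,s) ∈ [p, 1−p] for every r ≥ 1 and every integer s. -/
theorem sig_pos_aux (u : ℝ) : 0 < sig u := by
  unfold sig; positivity

theorem wfun_step (p : ℝ) (hp0 : 0 < p) (hp1 : p < 1 / 2) (β : ℝ)
    (hE : Real.exp (-(2 * β)) = p / (1 - p)) (t : ℤ) :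
    wfun β (t - 1) ≤ wfun β (t + 1) ∧ p * wfun β (t + 1) ≤ (1 - p) * wfun β (t - 1) := by
  have h1 : (0 : ℝ) < 1 - p := by linarith
  have hx : Real.exp (-(β * ((t + 1 : ℤ) : ℝ)))
      = Real.exp (-(β * ((t - 1 : ℤ) : ℝ))) * (p / (1 - p)) := by
    rw [← hE, ← Real.exp_add]; congr 1; push_cast; ring
  unfold wfun sig
  rw [hx]
  have hpos := Real.exp_pos (-(β * ((t - 1 : ℤ) : ℝ)))
  generalize Real.exp (-(β * ((t - 1 : ℤ) : ℝ))) = E at hpos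
  have hq : p / (1 - p) ≤ 1 := by rw [div_le_one h1]; linarith
  have hq0 : 0 < p / (1 - p) := by positivity
  have hqp : p / (1 - p) * (1 - p) = p := by field_simp
  generalize p / (1 - p) = q at *
  have hEq : 0 < E * q := by positivity
  constructor
  · have : 1 / (1 + E) ≤ 1 / (1 + E * q) := by
      apply one_div_le_one_div_of_le (by linarith)
      nlinarith
    linarith
  · have : p * (1 / (1 + E * q)) ≤ (1 - p) * (1 / (1 + E)) := by
      rw [mul_one_div, mul_one_div, div_le_div_iff₀ (by linarith) (by linarith)]
      have : (1 - p) * (1 + E * q) = 1 - p + E * p := by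
        linear_combination E * hqp
      rw [this]; linarith
    linarith

theorem Hrw_step (p : ℝ) (hp0 : 0 < p) (hp1 : p < 1 / 2) (β : ℝ)
    (hE : Real.exp (-(2 * β)) = p / (1 - p)) (r : ℕ) (s : ℤ) :
    Hrw β r (s - 1) ≤ Hrw β r (s + 1) ∧ p * Hrw β r (s + 1) ≤ (1 - p) * Hrw β r (s - 1) := by
  unfold Hrw
  constructor
  · apply mul_le_mul_of_nonneg_left _ (by positivity)
    apply Finset.sum_le_sum
    intro ξ _
    rw [sub_add_eq_add_sub, add_right_comm]
    exact (wfun_step p hp0 hp1 β hE _).1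
  · rw [mul_left_comm, mul_left_comm (1 - p)]
    apply mul_le_mul_of_nonneg_left _ (by positivity)
    rw [Finset.mul_sum, Finset.mul_sum]
    apply Finset.sum_le_sum
    intro ξ _
    rw [sub_add_eq_add_sub, add_right_comm]
    exact (wfun_step p hp0 hp1 β hE _).2

/-- **Channel-feasible biases for the majority sampler.**
Let `p ∈ (0, 1/2)` and set `β := (1/2)·log((1−p)/p)`.  Then `σ(2β) = 1 − p`
and `σ(−2β) = p`, and consequently `q(r,s) ∈ [p, 1−p]` for every `r ≥ 1` and
every integer `s`. -/
theorem stmt16 (p : ℝ) (hp0 : 0 < p) (hp1 : p < 1 / 2)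
    (β : ℝ) (hβ : β = (1 / 2) * Real.log ((1 - p) / p)) :
    sig (2 * β) = 1 - p
    ∧ sig (-(2 * β)) = p
    ∧ (∀ r : ℕ, 1 ≤ r → ∀ s : ℤ, p ≤ qmaj β r s ∧ qmaj β r s ≤ 1 - p) := by
  have h1 : (0 : ℝ) < 1 - p := by linarith
  have hq : 0 < (1 - p) / p := by positivity
  have hP : Real.exp (2 * β) = (1 - p) / p := by
    rw [hβ, ← mul_assoc]; norm_num; exact Real.exp_log hq
  have hE : Real.exp (-(2 * β)) = p / (1 - p) := by
    rw [Real.exp_neg, hP, inv_div]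
  refine ⟨?_, ?_, ?_⟩
  · unfold sig; rw [hE]; field_simp; ring
  · unfold sig; rw [neg_neg, hP]; field_simp; ring
  · intro r _ s
    obtain ⟨ha, hb⟩ := Hrw_step p hp0 hp1 β hE (r - 1) s
    have hA := Hrw_pos β (r - 1) (s + 1)
    have hB := Hrw_pos β (r - 1) (s - 1)
    unfold qmaj
    constructor
    · rw [le_div_iff₀ (by linarith)]; nlinarith
    · rw [div_le_iff₀ (by linarith)]; nlinarith
end

section
/- (Majority signaling with perfect uniformity) Let p ∈ (0,1/2) and set β := (1/2)·log((1−p)/p). There exists a constant C = C(p) < ∞ such that for every odd n ≥ 1 the following holds. Let o be uniform on {−1,+1} and let Y be distributed, conditionally on o, according to Pr[Y = y | o] = 2^{−(n−1)}·σ(β·o·S(y)), where S(y) := ∑_{i=1}^n y_i. Then: (1) the unconditional distribution of Y is exactly uniform on {−1,+1}^n; (2) the maximum a posteriori decoder of o from Y is the majority decoder sign(S(Y)); and (3) Pr[sign(S(Y)) ≠ o] ≤ C/√n. -/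
/-- `S(y) = ∑_i y_i` for `y ∈ {−1,+1}^n`, encoded via `Fin n → Bool`
(`true ↔ +1`). -/
def Sint {n : ℕ} (y : Fin n → Bool) : ℤ :=
  ∑ i, (if y i then (1 : ℤ) else -1)

/-- The joint weight `Pr[o = b, Y = y]` when `o` is uniform on `{−1,+1}`
(encoded as a `Bool`, `true ↔ +1`) and, conditionally on `o`,
`Pr[Y = y | o] = 2^{−(n−1)}·σ(β·o·S(y))`. -/
noncomputable def joint (n : ℕ) (β : ℝ) (b : Bool) (y : Fin n → Bool) : ℝ :=
  (1 / 2 : ℝ) * (1 / 2 ^ (n - 1) : ℝ) *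
    sig (β * (if b then (1 : ℝ) else -1) * (Sint y : ℝ))

lemma cb_bound (m : ℕ) : (Nat.centralBinom m) ^ 2 * (2 * m + 1) ≤ 16 ^ m := by
  induction m with
  | zero => simp
  | succ m ih =>
    have h := Nat.succ_mul_centralBinom_succ m
    have h2 : ((m + 1) * Nat.centralBinom (m + 1)) ^ 2 * (2 * (m + 1) + 1)
        ≤ (m + 1) ^ 2 * 16 ^ (m + 1) := by
      rw [h]
      calc (2 * (2 * m + 1) * Nat.centralBinom m) ^ 2 * (2 * (m + 1) + 1)
          = (Nat.centralBinom m ^ 2 * (2 * m + 1)) * (4 * (2 * m + 1) * (2 * m + 3)) := by ring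
        _ ≤ 16 ^ m * (16 * (m + 1) ^ 2) := by
            apply Nat.mul_le_mul ih
            nlinarith
        _ = _ := by ring
    have h3 : (m + 1) ^ 2 * (Nat.centralBinom (m + 1) ^ 2 * (2 * (m + 1) + 1))
        ≤ (m + 1) ^ 2 * 16 ^ (m + 1) := by
      calc _ = _ := by ring
        _ ≤ _ := h2
    exact Nat.le_of_mul_le_mul_left h3 (by positivity)

lemma choose_bound (m k : ℕ) :
    ((2 * m + 1).choose k : ℝ) ≤ 2 ^ (2 * m + 1) / Real.sqrt ((2 * m + 1 : ℕ) : ℝ) := by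
  have h1 : (2 * m + 1).choose k ≤ (2 * m + 1).choose m := by
    have := Nat.choose_le_middle k (2 * m + 1)
    rwa [show (2 * m + 1) / 2 = m by omega] at this
  have h2 : Nat.centralBinom (m + 1) = 2 * (2 * m + 1).choose m := by
    rw [Nat.centralBinom_eq_two_mul_choose, show 2 * (m + 1) = (2 * m + 1) + 1 by ring,
      Nat.choose_succ_succ, ← Nat.choose_symm_half m]
    ring
  have h3 := cb_bound (m + 1)
  rw [h2] at h3
  have h4 : ((2 * m + 1).choose m) ^ 2 * (2 * m + 1) ≤ (2 ^ (2 * m + 1)) ^ 2 := by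
    have e : (16 : ℕ) ^ (m + 1) = 4 * (2 ^ (2 * m + 1)) ^ 2 := by
      rw [← pow_mul, show (16 : ℕ) = 2 ^ 4 by norm_num, show (4 : ℕ) = 2 ^ 2 by norm_num,
        ← pow_mul, ← pow_add]
      congr 1; ring
    rw [e] at h3
    nlinarith [sq_nonneg ((2 * m + 1).choose m)]
  rw [le_div_iff₀ (by positivity)]
  have h5 : (((2 * m + 1).choose m : ℝ)) ^ 2 * ((2 * m + 1 : ℕ) : ℝ) ≤ (2 ^ (2 * m + 1)) ^ 2 := by
    exact_mod_cast h4
  calc ((2 * m + 1).choose k : ℝ) * Real.sqrt ((2 * m + 1 : ℕ) : ℝ)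
      ≤ ((2 * m + 1).choose m : ℝ) * Real.sqrt ((2 * m + 1 : ℕ) : ℝ) := by
        gcongr
    _ ≤ _ := by
        apply le_of_sq_le_sq _ (by positivity)
        rw [mul_pow, Real.sq_sqrt (by positivity)]
        exact h5

lemma exp_sum_bound (β : ℝ) (hβ : 0 < β) (m : ℕ) :
    ∑ k ∈ Finset.range (2 * m + 1 + 1), Real.exp (-(β * |2 * (k : ℝ) - (2 * m + 1 : ℕ)|))
      ≤ 2 / (1 - Real.exp (-β)) := by
  have hr1 : Real.exp (-β) < 1 := by simpa using hβ
  have hg : ∑ j ∈ Finset.range (m + 1), Real.exp (-β) ^ j ≤ 1 / (1 - Real.exp (-β)) := by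
    have h := geom_sum_mul_neg (Real.exp (-β)) (m + 1)
    rw [le_div_iff₀ (by linarith), h]
    have : 0 < Real.exp (-β) ^ (m + 1) := by positivity
    linarith
  have key : ∀ (j : ℕ) (x : ℝ), (j : ℝ) ≤ |x| → Real.exp (-(β * |x|)) ≤ Real.exp (-β) ^ j := by
    intro j x h
    rw [← Real.exp_nat_mul]
    apply Real.exp_le_exp.2
    nlinarith
  rw [show 2 * m + 1 + 1 = (m + 1) + (m + 1) by ring, Finset.sum_range_add]
  have e : 2 / (1 - Real.exp (-β)) = 1 / (1 - Real.exp (-β)) + 1 / (1 - Real.exp (-β)) := by ring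
  rw [e]
  apply add_le_add
  · refine le_trans ?_ hg
    rw [← Finset.sum_range_reflect]
    apply Finset.sum_le_sum
    intro j hj
    apply key
    have hj : j ≤ m := by simpa [Nat.lt_succ_iff] using hj
    rw [show m + 1 - 1 - j = m - j by omega, Nat.cast_sub hj, abs_sub_comm]
    refine le_trans ?_ (le_abs_self _)
    push_cast
    have : (0 : ℝ) ≤ j := by positivity
    linarith
  · refine le_trans ?_ hg
    apply Finset.sum_le_sum
    intro j hj
    apply key
    refine le_trans ?_ (le_abs_self _)
    push_cast
    have : (0 : ℝ) ≤ j := by positivity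
    linarith

lemma sum_card {n : ℕ} (g : ℝ → ℝ) :
    ∑ y : Fin n → Bool, g (Sint y : ℝ)
      = ∑ k ∈ Finset.range (n + 1), (n.choose k : ℝ) * g (2 * (k : ℝ) - n) := by
  have h := Finset.sum_powerset_apply_card (fun k : ℕ => g (2 * (k : ℝ) - n))
    (x := (Finset.univ : Finset (Fin n)))
  simp only [Finset.powerset_univ, Finset.card_univ, Fintype.card_fin, nsmul_eq_mul] at h
  rw [← h]
  symm
  refine Fintype.sum_bijective (fun (s : Finset (Fin n)) (i : Fin n) => decide (i ∈ s)) ?_ _ _ ?_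
  · constructor
    · intro s t hst
      ext i
      have := congrFun hst i
      simpa using this
    · intro y
      refine ⟨Finset.univ.filter (fun i => y i = true), ?_⟩
      ext i
      simp
  · intro s
    congr 1
    have : Sint (fun i => decide (i ∈ s)) = 2 * (s.card : ℤ) - n := by
      unfold Sint
      have : ∀ i : Fin n, (if decide (i ∈ s) = true then (1 : ℤ) else -1)
          = 2 * (if i ∈ s then 1 else 0) - 1 := by
        intro i; by_cases hi : i ∈ s <;> simp [hi]
      rw [Finset.sum_congr rfl (fun i _ => this i), Finset.sum_sub_distrib, ← Finset.mul_sum]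
      simp
    rw [this]; push_cast; ring

lemma half_pow (n : ℕ) (hn : 1 ≤ n) : (1 / 2 : ℝ) * (1 / 2 ^ (n - 1) : ℝ) = 1 / 2 ^ n := by
  obtain ⟨m, rfl⟩ := Nat.exists_eq_add_of_le' hn
  simp [pow_succ]

lemma sig_add (u : ℝ) : sig u + sig (-u) = 1 := by
  unfold sig
  have h := Real.exp_pos u
  rw [neg_neg, Real.exp_neg]
  field_simp
  ring

lemma sig_mono {u v : ℝ} (h : u ≤ v) : sig u ≤ sig v := by
  unfold sig
  have := Real.exp_pos (-v)
  gcongr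

lemma sig_le (u : ℝ) : sig (-u) ≤ Real.exp (-u) := by
  unfold sig
  rw [neg_neg, Real.exp_neg, one_div]
  apply inv_anti₀ (Real.exp_pos u)
  linarith

/-- **Majority signaling with perfect uniformity.**
Let `p ∈ (0, 1/2)` and set `β := (1/2)·log((1−p)/p)`.  There is a constant
`C = C(p) < ∞` such that for every odd `n ≥ 1`, with `o` uniform on `{−1,+1}`
and `Pr[Y = y | o] = 2^{−(n−1)}·σ(β·o·S(y))`:
(1) the unconditional distribution of `Y` is exactly uniform on `{−1,+1}^n`;
(2) the majority decoder `sign(S(Y))` is a maximum a posteriori decoder of `o`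
from `Y` (for every observed `y`, it maximizes the joint weight, equivalently
the posterior);
(3) `Pr[sign(S(Y)) ≠ o] ≤ C/√n`. -/
theorem stmt19 (p : ℝ) (hp0 : 0 < p) (hp1 : p < 1 / 2)
    (β : ℝ) (hβ : β = (1 / 2) * Real.log ((1 - p) / p)) :
    ∃ C : ℝ, ∀ n : ℕ, 1 ≤ n → Odd n →
      (∀ y : Fin n → Bool, joint n β true y + joint n β false y = 1 / 2 ^ n)
      ∧ (∀ y : Fin n → Bool, ∀ b : Bool,
          joint n β b y ≤ joint n β (decide (0 < Sint y)) y)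
      ∧ (∑ y : Fin n → Bool, ∑ b : Bool,
            joint n β b y * (if decide (0 < Sint y) = b then 0 else 1)
          ≤ C / Real.sqrt n) := by
  have hβ0 : 0 < β := by
    rw [hβ]
    have : 1 < (1 - p) / p := by rw [lt_div_iff₀ hp0]; linarith
    have := Real.log_pos this
    positivity
  refine ⟨2 / (1 - Real.exp (-β)), ?_⟩
  intro n hn hodd
  refine ⟨?_, ?_, ?_⟩
  · intro y
    unfold joint
    rw [half_pow n hn, ← mul_add]
    have := sig_add (β * (Sint y : ℝ))
    simp only [if_true, Bool.false_eq_true, if_false, mul_one, mul_neg, neg_mul, this]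
  · intro y b
    unfold joint
    rw [half_pow n hn]
    apply mul_le_mul_of_nonneg_left _ (by positivity)
    apply sig_mono
    by_cases hS : 0 < Sint y
    · have h2 : (0 : ℝ) < Sint y := by exact_mod_cast hS
      have := mul_pos hβ0 h2
      cases b <;> simp [hS] <;> linarith
    · have h2 : (Sint y : ℝ) ≤ 0 := by exact_mod_cast not_lt.1 hS
      have := mul_nonneg hβ0.le (neg_nonneg.2 h2)
      cases b <;> simp [hS] <;> linarith
  · obtain ⟨m, rfl⟩ := hodd
    set N := 2 * m + 1 with hN
    have step : ∀ y : Fin N → Bool, ∑ b : Bool,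
        joint N β b y * (if decide (0 < Sint y) = b then 0 else 1)
        ≤ 1 / 2 ^ N * Real.exp (-(β * |(Sint y : ℝ)|)) := by
      intro y
      rw [Fintype.sum_bool]
      unfold joint
      rw [half_pow N hn]
      have hs := sig_le (β * |(Sint y : ℝ)|)
      have hs' := mul_le_mul_of_nonneg_left hs (show (0 : ℝ) ≤ 1 / 2 ^ N by positivity)
      refine le_trans (le_of_eq ?_) hs'
      by_cases hS : 0 < Sint y
      · have h2 : (0 : ℝ) < Sint y := by exact_mod_cast hS
        simp [hS, abs_of_pos h2]
      · have h2 : (Sint y : ℝ) ≤ 0 := by exact_mod_cast not_lt.1 hS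
        simp [hS, abs_of_nonpos h2]
    refine (Finset.sum_le_sum (fun y _ => step y)).trans ?_
    rw [← Finset.mul_sum, sum_card (fun x => Real.exp (-(β * |x|)))]
    have hb := exp_sum_bound β hβ0 m
    have hsq : 0 < Real.sqrt (N : ℝ) := by positivity
    calc _ ≤ 1 / 2 ^ N * ∑ k ∈ Finset.range (N + 1), (2 ^ N / Real.sqrt (N : ℝ)) *
            Real.exp (-(β * |2 * (k : ℝ) - N|)) := by
          gcongr with k hk
          exact choose_bound m k
      _ = (∑ k ∈ Finset.range (N + 1), Real.exp (-(β * |2 * (k : ℝ) - N|)))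
            / Real.sqrt (N : ℝ) := by
          rw [← Finset.mul_sum]; field_simp
      _ ≤ _ := by
          gcongr
end
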